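/- In the risk-minimisation setting with a family 𝒢 of admissible functions g, define κ(L) := inf_{g∈𝒢} κ_g(L) for L ∈ 𝓔, and set κ* := x₀ / sup_{g∈𝒢} ∫₀¹ g(u) dμ(u). Then: (a) the optimal value of minimising κ(L) over L ∈ 𝓔 subject to E_Q[L] ≥ x₀ equals κ*; (b) if there exists g* ∈ 𝒢 attaining sup_{g∈𝒢} ∫₀¹ g(u) dμ(u), then L* := −κ*·(ĝ*)′₋(U) is a solution, where ĝ*(p) := (1−p)·g*(p); (c) if a solution exists and κ(L) = min_{g∈𝒢} κ_g(L) for every L ∈ 𝓔, then some g* ∈ 𝒢 attains sup_{g∈𝒢} ∫₀¹ g(u) dμ(u). -/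

import Mathlib

open MeasureTheory Filter Set

noncomputable section

namespace Paper

variable {Ω : Type*} [MeasurableSpace Ω]

/-- The probability measure `P` is atomless. -/
def Atomless (P : Measure Ω) : Prop :=
  ∀ s : Set Ω, MeasurableSet s → 0 < P s →
    ∃ t : Set Ω, MeasurableSet t ∧ t ⊆ s ∧ 0 < P t ∧ P t < P s

/-- `𝒳`: the essentially bounded random variables. -/
def MemX (P : Measure Ω) (X : Ω → ℝ) : Prop :=
  Measurable X ∧ ∃ C : ℝ, ∀ᵐ ω ∂P, |X ω| ≤ C

/-- `𝒰(I)`: twice differentiable functions with everywhere positive first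
derivative on `I`. -/
def IsUtility (I : Set ℝ) (u : ℝ → ℝ) : Prop :=
  (∀ x ∈ I, DifferentiableAt ℝ u x) ∧
  (∀ x ∈ I, DifferentiableAt ℝ (deriv u) x) ∧
  (∀ x ∈ I, 0 < deriv u x)

/-- Arrow–Pratt coefficient of absolute risk aversion. -/
def RA (u : ℝ → ℝ) (x : ℝ) : ℝ := -deriv (deriv u) x / deriv u x

/-- `𝓛¹_v`: `I`-valued random variables `X` with `v(X)` integrable. -/
def MemL1 (P : Measure Ω) (I : Set ℝ) (v : ℝ → ℝ) (X : Ω → ℝ) : Prop :=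
  Measurable X ∧ (∀ᵐ ω ∂P, X ω ∈ I) ∧ Integrable (fun ω => v (X ω)) P

/-- The `v`-SD order: `X ≤_{v-SD} Y`. -/
def vSD (P : Measure Ω) (I : Set ℝ) (v : ℝ → ℝ) (X Y : Ω → ℝ) : Prop :=
  ∀ u : ℝ → ℝ, IsUtility I u → (∀ x ∈ I, RA v x ≤ RA u x) →
    Integrable (fun ω => u (X ω)) P → Integrable (fun ω => u (Y ω)) P →
    ∫ ω, u (X ω) ∂P ≤ ∫ ω, u (Y ω) ∂P

/-- Second-order stochastic dominance. -/
def SSD (P : Measure Ω) (X Y : Ω → ℝ) : Prop :=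
  ∀ u : ℝ → ℝ, IsUtility Set.univ u → ConcaveOn ℝ Set.univ u →
    Integrable (fun ω => u (X ω)) P → Integrable (fun ω => u (Y ω)) P →
    ∫ ω, u (X ω) ∂P ≤ ∫ ω, u (Y ω) ∂P

/-- Monetary risk measure: antitone and cash-additive on `𝒳`. -/
def IsRiskMeasure (P : Measure Ω) (ρ : (Ω → ℝ) → ℝ) : Prop :=
  (∀ X Y : Ω → ℝ, MemX P X → MemX P Y → (∀ᵐ ω ∂P, X ω ≤ Y ω) → ρ Y ≤ ρ X) ∧
  (∀ X : Ω → ℝ, MemX P X → ∀ c : ℝ, ρ (fun ω => X ω + c) = ρ X - c)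

/-- Worst-case risk measure `ρ^w(X) = ess sup (-X)`. -/
def rhoW (P : Measure Ω) (X : Ω → ℝ) : ℝ :=
  sInf {m : ℝ | ∀ᵐ ω ∂P, -X ω ≤ m}

/-- `v`-SD-consistency of `φ` on the domain `D`. -/
def VSDConsistent (P : Measure Ω) (I : Set ℝ) (v : ℝ → ℝ)
    (D : Set (Ω → ℝ)) (φ : (Ω → ℝ) → ℝ) : Prop :=
  ∀ X Y : Ω → ℝ, X ∈ D → Y ∈ D → MemL1 P I v X → MemL1 P I v Y →
    vSD P I v X Y → φ Y ≤ φ X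

/-- `𝒞`: the a.s. strictly positive bounded random variables. -/
def MemC (P : Measure Ω) (X : Ω → ℝ) : Prop :=
  MemX P X ∧ ∀ᵐ ω ∂P, 0 < X ω

/-- `𝓔 = {e^Y : Y ∈ 𝒳}` (up to a.s. equality). -/
def MemE (P : Measure Ω) (X : Ω → ℝ) : Prop :=
  ∃ Y : Ω → ℝ, MemX P Y ∧ ∀ᵐ ω ∂P, X ω = Real.exp (Y ω)

/-- Return risk measure. -/
def IsRRM (P : Measure Ω) (η : (Ω → ℝ) → ℝ) : Prop :=
  (∀ X : Ω → ℝ, MemC P X → 0 < η X) ∧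
  (∀ X Y : Ω → ℝ, MemC P X → MemC P Y → (∀ᵐ ω ∂P, X ω ≤ Y ω) → η Y ≤ η X) ∧
  (∀ X : Ω → ℝ, MemC P X → ∀ t : ℝ, 0 < t → η (fun ω => t * X ω) = t⁻¹ * η X)

/-- Loss-based return risk measure. -/
def IsLossRRM (P : Measure Ω) (κ : (Ω → ℝ) → ℝ) : Prop :=
  (∀ L : Ω → ℝ, MemC P L → 0 < κ L) ∧
  (∀ L L' : Ω → ℝ, MemC P L → MemC P L' → (∀ᵐ ω ∂P, L' ω ≤ L ω) → κ L' ≤ κ L) ∧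
  (∀ L : Ω → ℝ, MemC P L → ∀ t : ℝ, 0 < t → κ (fun ω => t * L ω) = t * κ L)

/-- Base risk measure `ρ_{Z,v}`. -/
def baseRM (P : Measure Ω) (v : ℝ → ℝ) (Z X : Ω → ℝ) : ℝ :=
  sInf {m : ℝ | vSD P Set.univ v Z (fun ω => X ω + m)}

/-- Lower quantile function. -/
def qf (P : Measure Ω) (X : Ω → ℝ) (r : ℝ) : ℝ :=
  sInf {x : ℝ | r ≤ (P {ω | X ω ≤ x}).toReal}

/-- Expected Shortfall at level `p`. -/
def ES (P : Measure Ω) (p : ℝ) (X : Ω → ℝ) : ℝ :=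
  if p < 1 then -(1 / (1 - p)) * ∫ r in (0:ℝ)..(1 - p), qf P X r
  else rhoW P X

/-- Left derivative. -/
def lderiv (f : ℝ → ℝ) (p : ℝ) : ℝ := derivWithin f (Set.Iio p) p

/-- `κ_g(L) = sup_{p ∈ [0,1]} ES_p(-L) / g(p)`. -/
def kG (P : Measure Ω) (g : ℝ → ℝ) (L : Ω → ℝ) : ℝ :=
  ⨆ p : Set.Icc (0:ℝ) 1, ES P p.1 (fun ω => -L ω) / g p.1

/-- `∫₀¹ g dμ`, where `μ` has density `1 - t` with respect to `φ`. -/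
def intMu (φ : Measure ℝ) (g : ℝ → ℝ) : ℝ :=
  ∫ u, g u ∂(φ.withDensity fun t => ENNReal.ofReal (1 - t))

/-- Admissible functions `g : [0,1] → (0,∞)`: nondecreasing, continuous, with
`ĝ(p) = (1-p) g(p)` concave and left derivative `ĝ′₋` negative, bounded below
and bounded away from `0`. -/
def Admissible (g : ℝ → ℝ) : Prop :=
  MonotoneOn g (Set.Icc 0 1) ∧ ContinuousOn g (Set.Icc 0 1) ∧
  (∀ p ∈ Set.Icc (0:ℝ) 1, 0 < g p) ∧
  ConcaveOn ℝ (Set.Icc 0 1) (fun q => (1 - q) * g q) ∧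
  (∀ p ∈ Set.Ioo (0:ℝ) 1,
    DifferentiableWithinAt ℝ (fun q => (1 - q) * g q) (Set.Iio p) p) ∧
  ∃ m M : ℝ, 0 < M ∧ ∀ p ∈ Set.Ioo (0:ℝ) 1,
    m ≤ lderiv (fun q => (1 - q) * g q) p ∧
      lderiv (fun q => (1 - q) * g q) p ≤ -M

/-! ### Quantile functions -/

theorem toReal_eq_cdf (P : Measure Ω) [IsProbabilityMeasure P] {X : Ω → ℝ} (hX : Measurable X)
    (x : ℝ) : (P {ω | X ω ≤ x}).toReal = ProbabilityTheory.cdf (P.map X) x := by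
  have : IsProbabilityMeasure (P.map X) := Measure.isProbabilityMeasure_map hX.aemeasurable
  rw [ProbabilityTheory.cdf_eq_real, measureReal_def, Measure.map_apply hX measurableSet_Iic]
  rfl

theorem qf_le_iff (P : Measure Ω) [IsProbabilityMeasure P] {X : Ω → ℝ} (hX : Measurable X)
    {r : ℝ} (hr : r ∈ Ioo (0:ℝ) 1) (x : ℝ) :
    qf P X r ≤ x ↔ r ≤ (P {ω | X ω ≤ x}).toReal := by
  unfold qf
  simp only [toReal_eq_cdf P hX]
  set F := ProbabilityTheory.cdf (P.map X) with hF
  have hne : {x : ℝ | r ≤ F x}.Nonempty := by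
    have := (ProbabilityTheory.tendsto_cdf_atTop (P.map X)).eventually (lt_mem_nhds hr.2)
    obtain ⟨y, hy⟩ := this.exists
    exact ⟨y, hy.le⟩
  have hbd : BddBelow {x : ℝ | r ≤ F x} := by
    have := (ProbabilityTheory.tendsto_cdf_atBot (P.map X)).eventually (gt_mem_nhds hr.1)
    obtain ⟨y, hy⟩ := this.exists
    refine ⟨y, fun z hz => ?_⟩
    by_contra! h
    have := F.mono h.le
    have h2 : r ≤ F z := hz
    linarith
  constructor
  · intro h
    have hc : ContinuousWithinAt F (Ioi x) x := (F.right_continuous x).mono Ioi_subset_Ici_self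
    refine ge_of_tendsto hc ?_
    filter_upwards [self_mem_nhdsWithin] with y hy
    obtain ⟨s, hs, hsy⟩ := exists_lt_of_csInf_lt hne (lt_of_le_of_lt h hy)
    exact le_trans hs (F.mono hsy.le)
  · intro h
    exact csInf_le hbd h

theorem qf_monotoneOn (P : Measure Ω) [IsProbabilityMeasure P] {X : Ω → ℝ} (hX : Measurable X) :
    MonotoneOn (qf P X) (Ioo 0 1) := by
  intro r hr s hs hrs
  rw [qf_le_iff P hX hr]
  exact hrs.trans ((qf_le_iff P hX hs _).1 le_rfl)

theorem qf_aemeas (P : Measure Ω) [IsProbabilityMeasure P] {X : Ω → ℝ} (hX : Measurable X) :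
    AEMeasurable (qf P X) (volume.restrict (Ioo (0:ℝ) 1)) :=
  aemeasurable_restrict_of_monotoneOn measurableSet_Ioo (qf_monotoneOn P hX)

theorem qf_map (P : Measure Ω) [IsProbabilityMeasure P] {X : Ω → ℝ} (hX : Measurable X) :
    (volume.restrict (Ioo (0:ℝ) 1)).map (qf P X) = P.map X := by
  have : IsProbabilityMeasure (P.map X) := Measure.isProbabilityMeasure_map hX.aemeasurable
  have : IsFiniteMeasure (volume.restrict (Ioo (0:ℝ) 1)) := ⟨by simp⟩
  refine Measure.ext_of_Iic _ _ fun x => ?_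
  rw [Measure.map_apply_of_aemeasurable (qf_aemeas P hX) measurableSet_Iic,
    Measure.map_apply hX measurableSet_Iic]
  have h1 : (volume.restrict (Ioo (0:ℝ) 1)) (qf P X ⁻¹' Iic x) =
      (volume.restrict (Ioo (0:ℝ) 1)) (Iic (P {ω | X ω ≤ x}).toReal) := by
    apply measure_congr
    filter_upwards [ae_restrict_mem measurableSet_Ioo] with r hr
    exact propext (qf_le_iff P hX hr x)
  rw [h1, Measure.restrict_apply measurableSet_Iic]
  have hle : (P {ω | X ω ≤ x}).toReal ≤ 1 := by
    have := prob_le_one (μ := P) (s := {ω | X ω ≤ x})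
    exact ENNReal.toReal_le_of_le_ofReal zero_le_one (by simpa using this)
  have h2 : volume (Iic (P {ω | X ω ≤ x}).toReal ∩ Ioo (0:ℝ) 1) =
      volume (Ioc 0 (P {ω | X ω ≤ x}).toReal) := by
    apply measure_congr
    have : ∀ᵐ r : ℝ, r ≠ 1 := by simp [ae_iff]
    filter_upwards [this] with r hr
    apply propext
    constructor
    · rintro ⟨a, b, c⟩; exact ⟨b, a⟩
    · rintro ⟨a, b⟩; exact ⟨b, a, lt_of_le_of_ne (b.trans hle) hr⟩
  rw [h2, Real.volume_Ioc, sub_zero, ENNReal.ofReal_toReal (measure_ne_top _ _)]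
  rfl

/-- quantiles of bounded variables are bounded -/
theorem qf_bound (P : Measure Ω) [IsProbabilityMeasure P] {X : Ω → ℝ} (hX : Measurable X)
    {C : ℝ} (hC : ∀ᵐ ω ∂P, |X ω| ≤ C) {r : ℝ} (hr : r ∈ Ioo (0:ℝ) 1) :
    |qf P X r| ≤ C := by
  rw [abs_le]
  constructor
  · by_contra! h
    obtain ⟨y, hy1, hy2⟩ := exists_between h
    have h1 := (qf_le_iff P hX hr y).1 hy1.le
    have : P {ω | X ω ≤ y} = 0 := by
      rw [measure_eq_zero_iff_ae_notMem]
      filter_upwards [hC] with ω hω hh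
      have := (abs_le.1 hω).1
      have h3 : X ω ≤ y := hh
      linarith
    rw [this] at h1
    simp at h1
    linarith [hr.1]
  · rw [qf_le_iff P hX hr]
    have : P {ω | X ω ≤ C} = 1 := by
      rw [← mem_ae_iff_prob_eq_one (measurableSet_le hX measurable_const)]
      filter_upwards [hC] with ω hω
      exact (abs_le.1 hω).2
    rw [this]
    simpa using hr.2.le

theorem qf_intble (P : Measure Ω) [IsProbabilityMeasure P] {X : Ω → ℝ} (hX : Measurable X)
    {C : ℝ} (hC : ∀ᵐ ω ∂P, |X ω| ≤ C) :
    IntegrableOn (qf P X) (Ioo (0:ℝ) 1) := by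
  have : IsFiniteMeasure (volume.restrict (Ioo (0:ℝ) 1)) := ⟨by simp⟩
  refine Integrable.of_bound (qf_aemeas P hX).aestronglyMeasurable C ?_
  filter_upwards [ae_restrict_mem measurableSet_Ioo] with r hr
  exact qf_bound P hX hC hr

theorem qf_congr (P : Measure Ω) {X Y : Ω → ℝ} (h : X =ᵐ[P] Y) (r : ℝ) :
    qf P X r = qf P Y r := by
  unfold qf
  have : ∀ x, P {ω | X ω ≤ x} = P {ω | Y ω ≤ x} := by
    intro x
    apply measure_congr
    filter_upwards [h] with ω hω
    apply propext
    change X ω ≤ x ↔ Y ω ≤ x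
    rw [hω]
  simp only [this]

theorem ES_congr (P : Measure Ω) {X Y : Ω → ℝ} (h : X =ᵐ[P] Y) (p : ℝ) :
    ES P p X = ES P p Y := by
  have h1 : qf P X = qf P Y := funext (qf_congr P h)
  have h2 : rhoW P X = rhoW P Y := by
    unfold rhoW
    congr 1
    ext m
    change (∀ᵐ ω ∂P, -X ω ≤ m) ↔ (∀ᵐ ω ∂P, -Y ω ≤ m)
    apply eventually_congr
    filter_upwards [h] with ω hω
    rw [hω]
  unfold ES
  rw [h1, h2]

theorem kG_congr (P : Measure Ω) (g : ℝ → ℝ) {X Y : Ω → ℝ} (h : X =ᵐ[P] Y) :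
    kG P g X = kG P g Y := by
  unfold kG
  congr 1
  ext p
  rw [ES_congr P (X := fun ω => -X ω) (Y := fun ω => -Y ω)]
  filter_upwards [h] with ω hω
  rw [hω]

/-- Lower tail integral of the quantile function is at most any integral over a set of the
same mass. -/
theorem qf_tail_le (P : Measure Ω) [IsProbabilityMeasure P] {X : Ω → ℝ} (hX : Measurable X)
    {C : ℝ} (hC : ∀ᵐ ω ∂P, |X ω| ≤ C) {A : Set Ω} (hA : MeasurableSet A) {a : ℝ}
    (ha : a ∈ Ioc (0:ℝ) 1) (hPA : P.real A = a) :
    ∫ r in (0:ℝ)..a, qf P X r ≤ ∫ ω in A, X ω ∂P := by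
  obtain ⟨c, hc1, hc2⟩ : ∃ c, (∀ r ∈ Ioo (0:ℝ) 1, r ≤ a → qf P X r ≤ c) ∧
      (∀ r ∈ Ioo (0:ℝ) 1, a < r → c ≤ qf P X r) := by
    rcases lt_or_eq_of_le ha.2 with h | h
    · refine ⟨qf P X a, fun r hr hra => qf_monotoneOn P hX hr ⟨ha.1, h⟩ hra,
        fun r hr hra => qf_monotoneOn P hX ⟨ha.1, h⟩ hr hra.le⟩
    · refine ⟨C, fun r hr _ => (abs_le.1 (qf_bound P hX hC hr)).2, fun r hr hra => ?_⟩
      exact absurd hr.2 (by rw [h] at hra; exact hra.le.not_gt)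
  have hXi : Integrable X P := by
    refine Integrable.of_bound hX.aestronglyMeasurable C ?_
    simpa using hC
  have hmi : Integrable (fun ω => min (X ω) c - c) P :=
    (hXi.inf (integrable_const c)).sub (integrable_const c)
  have hq := qf_intble P hX hC
  have : IsFiniteMeasure (volume.restrict (Ioo (0:ℝ) 1)) := ⟨by simp⟩
  have hqm : IntegrableOn (fun r => min (qf P X r) c - c) (Ioo (0:ℝ) 1) :=
    (hq.inf (integrable_const c)).sub (integrable_const c)
  have e1 : ∫ ω, (min (X ω) c - c) ∂P = ∫ r in Ioo (0:ℝ) 1, (min (qf P X r) c - c) := by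
    have m : AEStronglyMeasurable (fun x : ℝ => min x c - c) (P.map X) :=
      ((measurable_id.min measurable_const).sub measurable_const).aestronglyMeasurable
    rw [← integral_map (f := fun x => min x c - c) hX.aemeasurable m, ← qf_map P hX,
      integral_map (qf_aemeas P hX)]
    rw [qf_map P hX]; exact m
  have hsub : Ioo (0:ℝ) a ⊆ Ioo 0 1 := Ioo_subset_Ioo_right ha.2
  have e2 : ∫ r in Ioo (0:ℝ) 1, (min (qf P X r) c - c) = ∫ r in Ioo (0:ℝ) a, (qf P X r - c) := by
    have : ∫ r in Ioo (0:ℝ) 1, (min (qf P X r) c - c) =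
        ∫ r in Ioo (0:ℝ) 1, (Ioo (0:ℝ) a).indicator (fun r => qf P X r - c) r := by
      apply integral_congr_ae
      have hne : ∀ᵐ r : ℝ ∂(volume.restrict (Ioo (0:ℝ) 1)), r ≠ a :=
        ae_restrict_of_ae (by simp [ae_iff])
      filter_upwards [ae_restrict_mem measurableSet_Ioo, hne] with r hr hra
      by_cases h : r < a
      · rw [indicator_of_mem (show r ∈ Ioo 0 a from ⟨hr.1, h⟩), min_eq_left (hc1 r hr h.le)]
      · rw [indicator_of_notMem (fun h' => h h'.2)]
        have : a < r := lt_of_le_of_ne (not_lt.1 h) (Ne.symm hra)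
        rw [min_eq_right (hc2 r hr this), sub_self]
    rw [this, setIntegral_indicator measurableSet_Ioo, inter_eq_right.2 hsub]
  have e3 : ∫ r in Ioo (0:ℝ) a, (qf P X r - c) = (∫ r in (0:ℝ)..a, qf P X r) - c * a := by
    rw [integral_sub (hq.mono_set hsub) (by simp), intervalIntegral.integral_of_le ha.1.le,
      integral_Ioc_eq_integral_Ioo]
    simp [ha.1.le, mul_comm]
  have e4 : ∫ ω, (min (X ω) c - c) ∂P ≤ ∫ ω in A, (min (X ω) c - c) ∂P := by
    rw [← integral_add_compl hA hmi]
    have : ∫ ω in Aᶜ, (min (X ω) c - c) ∂P ≤ 0 :=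
      integral_nonpos fun ω => by simp
    linarith
  have e5 : ∫ ω in A, (min (X ω) c - c) ∂P ≤ ∫ ω in A, (X ω - c) ∂P :=
    integral_mono hmi.integrableOn (hXi.sub (integrable_const c)).integrableOn
      fun ω => by simp
  have e6 : ∫ ω in A, (X ω - c) ∂P = (∫ ω in A, X ω ∂P) - c * a := by
    rw [integral_sub hXi.integrableOn (integrable_const c).integrableOn]
    simp [hPA, mul_comm]
  linarith

/-! ### Admissible functions -/

/-- minus the left derivative of `ĝ` -/
def hh (g : ℝ → ℝ) (u : ℝ) : ℝ := -lderiv (fun q => (1 - q) * g q) u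

theorem hh_bounds {g : ℝ → ℝ} (hg : Admissible g) :
    ∃ m M : ℝ, 0 < m ∧ ∀ u ∈ Ioo (0:ℝ) 1, m ≤ hh g u ∧ hh g u ≤ M := by
  obtain ⟨-, -, -, -, -, m, M, hM, h⟩ := hg
  refine ⟨M, -m, hM, fun u hu => ?_⟩
  have := h u hu
  unfold hh
  constructor <;> linarith

theorem hh_mono {g : ℝ → ℝ} (hg : Admissible g) : MonotoneOn (hh g) (Ioo 0 1) := by
  obtain ⟨-, -, -, hc, hd, -⟩ := hg
  have h1 := hc.neg.monotoneOn_leftDeriv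
  rw [interior_Icc] at h1
  intro u hu v hv huv
  have h2 := h1 hu hv huv
  unfold hh lderiv
  simp only [derivWithin.neg] at h2
  exact h2

theorem hh_le {g : ℝ → ℝ} (hg : Admissible g) {u : ℝ} (hu : u ∈ Ioo (0:ℝ) 1) :
    hh g u ≤ g 1 := by
  obtain ⟨hmono, -, -, hc, hd, -⟩ := hg
  have hui : u ∈ interior (Icc (0:ℝ) 1) := by rwa [interior_Icc]
  have hu' : u ∈ Icc (0:ℝ) 1 := ⟨hu.1.le, hu.2.le⟩
  have h1 : (1:ℝ) ∈ Icc (0:ℝ) 1 := by simp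
  have a1 := hc.neg.leftDeriv_le_rightDeriv_of_mem_interior hui
  have a2 := hc.neg.rightDeriv_le_slope_of_mem_interior hui h1 hu.2
  have a3 := a1.trans a2
  simp only [derivWithin.neg] at a3
  have hpos : 0 < 1 - u := by linarith [hu.2]
  have a4 : slope (-fun q => (1 - q) * g q) u 1 = g u := by
    rw [slope_def_field]
    simp
    field_simp
  rw [a4] at a3
  exact a3.trans (hmono hu' h1 hu.2.le)

theorem hh_aemeas {g : ℝ → ℝ} (hg : Admissible g) :
    AEMeasurable (hh g) (volume.restrict (Ioo (0:ℝ) 1)) :=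
  aemeasurable_restrict_of_monotoneOn measurableSet_Ioo (hh_mono hg)

theorem hh_intble {g : ℝ → ℝ} (hg : Admissible g) : IntegrableOn (hh g) (Ioo (0:ℝ) 1) := by
  have : IsFiniteMeasure (volume.restrict (Ioo (0:ℝ) 1)) := ⟨by simp⟩
  obtain ⟨m, M, hm, h⟩ := hh_bounds hg
  refine Integrable.of_bound (hh_aemeas hg).aestronglyMeasurable M ?_
  filter_upwards [ae_restrict_mem measurableSet_Ioo] with r hr
  rw [Real.norm_eq_abs, abs_of_nonneg (hm.le.trans (h r hr).1)]
  exact (h r hr).2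

theorem hh_refl_ftc {g : ℝ → ℝ} (hg : Admissible g) {a : ℝ} (ha : a ∈ Icc (0:ℝ) 1) :
    ∫ x in (0:ℝ)..a, hh g (1 - x) = a * g (1 - a) := by
  have hint := hh_intble hg
  obtain ⟨hmono, hcont, -, hc, hd, -⟩ := hg
  have key : ∫ x in (0:ℝ)..a, hh g (1 - x) =
      (1 - (1 - a)) * g (1 - a) - (1 - (1 - 0)) * g (1 - 0) := by
    refine intervalIntegral.integral_eq_sub_of_hasDeriv_right_of_le
      (f := fun x => (1 - (1 - x)) * g (1 - x)) ha.1 ?_ ?_ ?_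
    · apply ContinuousOn.mul (by fun_prop)
      refine hcont.comp (by fun_prop) ?_
      intro x hx
      exact ⟨by linarith [hx.2, ha.2], by linarith [hx.1]⟩
    · intro x hx
      have hx' : 1 - x ∈ Ioo (0:ℝ) 1 := ⟨by linarith [hx.2, ha.2], by linarith [hx.1]⟩
      have d1 := (hd (1 - x) hx').hasDerivWithinAt
      have d2 : HasDerivWithinAt (fun y : ℝ => 1 - y) (-1) (Ioi x) x := by
        simpa using ((hasDerivAt_id x).const_sub 1).hasDerivWithinAt
      have d3 := HasDerivWithinAt.comp x d1 d2 (fun y hy => by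
        have : x < y := hy
        change 1 - y < 1 - x
        linarith)
      refine d3.congr_deriv ?_
      unfold hh lderiv
      ring
    · have h1 : IntervalIntegrable (hh g) volume 0 1 := by
        rw [intervalIntegrable_iff_integrableOn_Ioo_of_le zero_le_one]; exact hint
      have h2 := (h1.comp_sub_left 1).symm
      simp only [sub_self, sub_zero] at h2
      refine h2.mono_set ?_
      rw [uIcc_of_le ha.1, uIcc_of_le zero_le_one]
      exact Icc_subset_Icc_right ha.2
  rw [key]; simp

theorem hh_ftc {g : ℝ → ℝ} (hg : Admissible g) {t : ℝ} (ht : t ∈ Ico (0:ℝ) 1) :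
    ∫ u in Ioo t 1, hh g u = (1 - t) * g t := by
  have h := hh_refl_ftc hg (a := 1 - t) ⟨by linarith [ht.2], by linarith [ht.1]⟩
  rw [intervalIntegral.integral_comp_sub_left (fun x => hh g x) 1] at h
  simp only [sub_sub_cancel, sub_zero] at h
  rw [intervalIntegral.integral_of_le ht.2.le, integral_Ioc_eq_integral_Ioo] at h
  exact h

/-- tail of the quantile of `-c h(U)` -/
theorem ES_hh_le (P : Measure Ω) [IsProbabilityMeasure P] {U : Ω → ℝ} (hU : Measurable U)
    (hUd : P.map U = volume.restrict (Ioo (0:ℝ) 1)) {g : ℝ → ℝ} (hg : Admissible g)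
    {c : ℝ} (hc : 0 ≤ c) {p : ℝ} (hp : p ∈ Icc (0:ℝ) 1) :
    ES P p (fun ω => -(c * hh g (U ω))) ≤ c * g p := by
  have hUmem : ∀ᵐ ω ∂P, U ω ∈ Ioo (0:ℝ) 1 := by
    have : ∀ᵐ u ∂(P.map U), u ∈ Ioo (0:ℝ) 1 := by
      rw [hUd]; exact ae_restrict_mem measurableSet_Ioo
    exact ae_of_ae_map hU.aemeasurable this
  obtain ⟨m, M, hm, hmM⟩ := hh_bounds hg
  unfold ES
  split_ifs with hp1
  · -- a measurable version
    have haem : AEMeasurable (fun ω => -(c * hh g (U ω))) P := by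
      have : AEMeasurable (fun ω => hh g (U ω)) P :=
        AEMeasurable.comp_aemeasurable (g := hh g) (f := U) (by rw [hUd]; exact hh_aemeas hg)
          hU.aemeasurable
      exact (this.const_mul c).neg
    set X := haem.mk with hXdef
    have hXe := haem.ae_eq_mk
    have hXm := haem.measurable_mk
    have hXb : ∀ᵐ ω ∂P, |X ω| ≤ c * M := by
      filter_upwards [hXe, hUmem] with ω h1 h2
      rw [hXdef, ← h1, abs_neg, abs_of_nonneg (mul_nonneg hc (hm.le.trans (hmM _ h2).1))]
      exact mul_le_mul_of_nonneg_left (hmM _ h2).2 hc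
    have hq : qf P (fun ω => -(c * hh g (U ω))) = qf P X := funext (qf_congr P hXe)
    rw [hq]
    set k : ℝ → ℝ := fun v => -(c * hh g (1 - v)) with hk
    have refl : ∀ v ∈ Ioo (0:ℝ) 1, 1 - v ∈ Ioo (0:ℝ) 1 := fun v hv =>
      ⟨by linarith [hv.2], by linarith [hv.1]⟩
    have hkm : MonotoneOn k (Ioo 0 1) := by
      intro u hu v hv huv
      have := hh_mono hg (refl v hv) (refl u hu) (by linarith)
      simp only [hk]
      have := mul_le_mul_of_nonneg_left this hc
      linarith
    have hlow : ∀ r ∈ Ioo (0:ℝ) 1, ∀ s ∈ Ioo (0:ℝ) 1, s < r → k s ≤ qf P X r := by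
      intro r hr s hs hsr
      by_contra! h
      have h1 := (qf_le_iff P hXm hr _).1 le_rfl
      have h2 : P {ω | X ω ≤ qf P X r} ≤ ENNReal.ofReal s := by
        calc P {ω | X ω ≤ qf P X r} ≤ P (U ⁻¹' (Ioi (1 - s))) := by
              apply measure_mono_ae
              filter_upwards [hXe, hUmem] with ω w1 w2 w3
              change 1 - s < U ω
              by_contra! w4
              have w5 : X ω ≤ qf P X r := w3
              rw [hXdef, ← w1] at w5
              have w6 := hh_mono hg w2 (refl s hs) w4
              have := mul_le_mul_of_nonneg_left w6 hc
              simp only [hk] at h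
              linarith
          _ = ENNReal.ofReal s := by
              rw [← Measure.map_apply hU measurableSet_Ioi, hUd,
                Measure.restrict_apply measurableSet_Ioi]
              have : Ioi (1 - s) ∩ Ioo (0:ℝ) 1 = Ioo (1 - s) 1 := by
                ext x
                constructor
                · rintro ⟨a, b, c⟩; exact ⟨a, c⟩
                · rintro ⟨a, b⟩; exact ⟨a, by linarith [hs.2], b⟩
              rw [this, Real.volume_Ioo]
              congr 1; ring
      have h3 := ENNReal.toReal_le_of_le_ofReal hs.1.le h2
      linarith
    have hae : ∀ᵐ r ∂(volume.restrict (Ioo (0:ℝ) 1)), k r ≤ qf P X r := by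
      have hcount := hkm.countable_not_continuousWithinAt
      have hz : ∀ᵐ r : ℝ ∂(volume.restrict (Ioo (0:ℝ) 1)),
          r ∉ {x | x ∈ Ioo (0:ℝ) 1 ∧ ¬ContinuousWithinAt k (Ioo 0 1) x} :=
        ae_restrict_of_ae (measure_eq_zero_iff_ae_notMem.1 (hcount.measure_zero _))
      filter_upwards [hz, ae_restrict_mem measurableSet_Ioo] with r hr hr1
      have hcw : ContinuousWithinAt k (Ioo 0 1) r := by
        by_contra h
        exact hr ⟨hr1, h⟩
      have hca : ContinuousAt k r := hcw.continuousAt (Ioo_mem_nhds hr1.1 hr1.2)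
      have ht : Tendsto k (nhdsWithin r (Iio r)) (nhds (k r)) := hca.continuousWithinAt
      refine le_of_tendsto ht ?_
      filter_upwards [Ioo_mem_nhdsLT hr1.1] with s hs
      exact hlow r hr1 s ⟨hs.1, hs.2.trans hr1.2⟩ hs.2
    have hpa : (0:ℝ) < 1 - p := by linarith
    have hsub : Ioo (0:ℝ) (1 - p) ⊆ Ioo 0 1 := Ioo_subset_Ioo_right (by linarith [hp.1])
    have hki : IntegrableOn k (Ioo (0:ℝ) 1) := by
      have h1 : IntervalIntegrable (hh g) volume 0 1 := by
        rw [intervalIntegrable_iff_integrableOn_Ioo_of_le zero_le_one]; exact hh_intble hg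
      have h2 := (h1.comp_sub_left 1).symm
      simp only [sub_self, sub_zero] at h2
      rw [intervalIntegrable_iff_integrableOn_Ioo_of_le zero_le_one] at h2
      exact (h2.const_mul c).neg
    have hI : ∫ r in (0:ℝ)..(1 - p), k r ≤ ∫ r in (0:ℝ)..(1 - p), qf P X r := by
      rw [intervalIntegral.integral_of_le hpa.le, intervalIntegral.integral_of_le hpa.le,
        integral_Ioc_eq_integral_Ioo, integral_Ioc_eq_integral_Ioo]
      exact setIntegral_mono_ae_restrict (hki.mono_set hsub) ((qf_intble P hXm hXb).mono_set hsub)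
        (ae_restrict_of_ae_restrict_of_subset hsub hae)
    have hkI : ∫ r in (0:ℝ)..(1 - p), k r = -(c * ((1 - p) * g p)) := by
      have := hh_refl_ftc hg (a := 1 - p) ⟨hpa.le, by linarith [hp.1]⟩
      simp only [hk, intervalIntegral.integral_neg, intervalIntegral.integral_const_mul, this,
        sub_sub_cancel]
    rw [hkI] at hI
    have : c * g p = -(1 / (1 - p)) * (-(c * ((1 - p) * g p))) := by field_simp
    rw [this]
    apply mul_le_mul_of_nonpos_left hI
    have : 0 < 1 / (1 - p) := by positivity
    linarith
  · have hp' : p = 1 := le_antisymm hp.2 (not_lt.1 hp1)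
    subst hp'
    unfold rhoW
    apply csInf_le
    · refine ⟨0, fun y hy => ?_⟩
      have hy' : ∀ᵐ ω ∂P, - -(c * hh g (U ω)) ≤ y := hy
      obtain ⟨ω, w1, w2⟩ := (hy'.and hUmem).exists
      have := mul_nonneg hc (hm.le.trans (hmM _ w2).1)
      linarith
    · change ∀ᵐ ω ∂P, - -(c * hh g (U ω)) ≤ c * g 1
      filter_upwards [hUmem] with ω hω
      rw [neg_neg]
      exact mul_le_mul_of_nonneg_left (hh_le hg hω) hc

theorem kG_hh_le (P : Measure Ω) [IsProbabilityMeasure P] {U : Ω → ℝ} (hU : Measurable U)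
    (hUd : P.map U = volume.restrict (Ioo (0:ℝ) 1)) {g : ℝ → ℝ} (hg : Admissible g)
    {c : ℝ} (hc : 0 ≤ c) :
    kG P g (fun ω => c * hh g (U ω)) ≤ c := by
  unfold kG
  have : Nonempty (Icc (0:ℝ) 1) := ⟨⟨0, by simp⟩⟩
  apply ciSup_le
  rintro ⟨p, hp⟩
  rw [div_le_iff₀ (hg.2.2.1 p hp)]
  exact ES_hh_le P hU hUd hg hc hp

/-! ### The measure `φ` -/

theorem psi_sigmaFinite (φ : Measure ℝ) (hφfin : ∀ t : ℝ, t < 1 → φ (Icc 0 t) ≠ ⊤) :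
    SigmaFinite (φ.restrict (Ico (0:ℝ) 1)) := by
  refine ⟨⟨⟨fun n : ℕ => Iic (1 - 1 / ((n:ℝ) + 1)) ∪ Ici 1, fun _ => trivial, fun n => ?_, ?_⟩⟩⟩
  · have hpos : (0:ℝ) < 1 / ((n:ℝ) + 1) := by positivity
    rw [Measure.restrict_apply (measurableSet_Iic.union measurableSet_Ici)]
    refine lt_of_le_of_lt (measure_mono ?_)
      (lt_top_iff_ne_top.2 (hφfin (1 - 1 / ((n:ℝ) + 1)) (by linarith)))
    rintro x ⟨h1 | h1, h2⟩
    · exact ⟨h2.1, h1⟩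
    · exact absurd h2.2 (not_lt.2 h1)
  · rw [eq_univ_iff_forall]
    intro x
    rw [mem_iUnion]
    by_cases hx : x < 1
    · obtain ⟨n, hn⟩ := exists_nat_one_div_lt (show (0:ℝ) < 1 - x by linarith)
      exact ⟨n, Or.inl (show x ≤ _ by linarith)⟩
    · exact ⟨0, Or.inr (not_lt.1 hx)⟩

theorem D_eq_psi (P : Measure Ω) [IsProbabilityMeasure P]
    (D : Ω → ℝ) (hDmeas : Measurable D)
    (U : Ω → ℝ) (hUmeas : Measurable U)
    (hUdist : P.map U = volume.restrict (Set.Ioo (0:ℝ) 1))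
    (hDU : ∀ᵐ ω ∂P, D ω = qf P D (U ω))
    (φ : Measure ℝ) (hφfin : ∀ t : ℝ, t < 1 → φ (Set.Icc 0 t) ≠ ⊤)
    (hφ : ∀ t ∈ Set.Ico (0:ℝ) 1,
      (φ (Set.Icc 0 t)).toReal = Function.rightLim (qf P D) t) :
    ∀ᵐ ω ∂P, ENNReal.ofReal (D ω) = (φ.restrict (Ico (0:ℝ) 1)) (Iic (U ω)) := by
  have h1 : ∀ᵐ u ∂(volume.restrict (Ioo (0:ℝ) 1)),
      ENNReal.ofReal (qf P D u) = (φ.restrict (Ico (0:ℝ) 1)) (Iic u) := by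
    have hcount := (qf_monotoneOn P hDmeas).countable_not_continuousWithinAt
    have hz : ∀ᵐ r : ℝ ∂(volume.restrict (Ioo (0:ℝ) 1)),
        r ∉ {x | x ∈ Ioo (0:ℝ) 1 ∧ ¬ContinuousWithinAt (qf P D) (Ioo 0 1) x} :=
      ae_restrict_of_ae (measure_eq_zero_iff_ae_notMem.1 (hcount.measure_zero _))
    filter_upwards [hz, ae_restrict_mem measurableSet_Ioo] with r hr hr1
    have hcw : ContinuousWithinAt (qf P D) (Ioo 0 1) r := by
      by_contra h
      exact hr ⟨hr1, h⟩
    have hca : ContinuousAt (qf P D) r := hcw.continuousAt (Ioo_mem_nhds hr1.1 hr1.2)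
    have h2 := hφ r ⟨hr1.1.le, hr1.2⟩
    rw [hca.continuousWithinAt.rightLim_eq] at h2
    rw [← h2, ENNReal.ofReal_toReal (hφfin r hr1.2), Measure.restrict_apply measurableSet_Iic]
    congr 1
    ext x
    constructor
    · rintro ⟨a, b⟩; exact ⟨b, a, b.trans_lt hr1.2⟩
    · rintro ⟨a, b, _⟩; exact ⟨b, a⟩
  rw [← hUdist] at h1
  filter_upwards [ae_of_ae_map hUmeas.aemeasurable h1, hDU] with ω w1 w2
  rw [w2, w1]

theorem fubini_D (P : Measure Ω) [IsProbabilityMeasure P]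
    (D : Ω → ℝ) (U : Ω → ℝ) (hUmeas : Measurable U)
    (ψ : Measure ℝ) [SigmaFinite ψ]
    (hD : ∀ᵐ ω ∂P, ENNReal.ofReal (D ω) = ψ (Iic (U ω)))
    (F : Ω → ENNReal) (hF : AEMeasurable F P) :
    ∫⁻ ω, F ω * ENNReal.ofReal (D ω) ∂P = ∫⁻ t, (∫⁻ ω in U ⁻¹' (Ici t), F ω ∂P) ∂ψ := by
  have hS : MeasurableSet {x : Ω × ℝ | x.2 ≤ U x.1} :=
    measurableSet_le measurable_snd (hUmeas.comp measurable_fst)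
  have h1 : ∫⁻ ω, F ω * ENNReal.ofReal (D ω) ∂P =
      ∫⁻ ω, (∫⁻ t, hF.mk F ω * ({x : Ω × ℝ | x.2 ≤ U x.1}.indicator 1 (ω, t)) ∂ψ) ∂P := by
    apply lintegral_congr_ae
    filter_upwards [hD, hF.ae_eq_mk] with ω w1 w2
    rw [w1, w2, lintegral_const_mul]
    · congr 1
      rw [← lintegral_indicator_one measurableSet_Iic]
      rfl
    · exact (measurable_one.indicator hS).comp measurable_prodMk_left
  rw [h1, lintegral_lintegral_swap]
  · apply lintegral_congr
    intro t
    rw [← lintegral_indicator (hUmeas measurableSet_Ici)]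
    apply lintegral_congr_ae
    filter_upwards [hF.ae_eq_mk] with ω w2
    by_cases h : t ≤ U ω
    · rw [indicator_of_mem (show ω ∈ U ⁻¹' (Ici t) from h),
        indicator_of_mem (show (ω, t) ∈ {x : Ω × ℝ | x.2 ≤ U x.1} from h), w2]
      simp
    · rw [indicator_of_notMem (show ω ∉ U ⁻¹' (Ici t) from h),
        indicator_of_notMem (show (ω, t) ∉ {x : Ω × ℝ | x.2 ≤ U x.1} from h), mul_zero]
  · exact ((hF.measurable_mk.comp measurable_fst).mul (measurable_one.indicator hS)).aemeasurable

theorem intMu_eq (φ : Measure ℝ) (hφsupp : φ (Icc (0:ℝ) 1)ᶜ = 0) {g : ℝ → ℝ}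
    (hg : Admissible g) :
    intMu φ g = (∫⁻ t, ENNReal.ofReal ((1 - t) * g t) ∂(φ.restrict (Ico (0:ℝ) 1))).toReal := by
  have hmem : ∀ᵐ t ∂φ, t ∈ Icc (0:ℝ) 1 := hφsupp
  have hres : φ.restrict (Icc (0:ℝ) 1) = φ := Measure.restrict_eq_self_of_ae_mem hmem
  have hgm : AEMeasurable g φ := by
    have := hg.2.1.aemeasurable (μ := φ) measurableSet_Icc
    rwa [hres] at this
  have hden : Measurable fun t : ℝ => ENNReal.ofReal (1 - t) := by fun_prop
  have hac := withDensity_absolutelyContinuous φ (fun t : ℝ => ENNReal.ofReal (1 - t))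
  unfold intMu
  rw [integral_eq_lintegral_of_nonneg_ae]
  · congr 1
    rw [lintegral_withDensity_eq_lintegral_mul₀ hden.aemeasurable hgm.ennreal_ofReal,
      ← lintegral_indicator measurableSet_Ico]
    apply lintegral_congr_ae
    filter_upwards [hmem] with t ht
    rcases lt_or_eq_of_le ht.2 with h | h
    · rw [indicator_of_mem (show t ∈ Ico (0:ℝ) 1 from ⟨ht.1, h⟩),
        ENNReal.ofReal_mul (by linarith)]
      rfl
    · rw [indicator_of_notMem (fun h' => by linarith [h'.2])]
      simp [h]
  · filter_upwards [hac.ae_le hmem] with t ht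
    exact (hg.2.2.1 t ht).le
  · exact (hgm.mono_ac hac).aestronglyMeasurable

theorem tail_hh (P : Measure Ω) [IsProbabilityMeasure P] {U : Ω → ℝ} (hU : Measurable U)
    (hUd : P.map U = volume.restrict (Ioo (0:ℝ) 1)) {g : ℝ → ℝ} (hg : Admissible g)
    {t : ℝ} (ht : t ∈ Ico (0:ℝ) 1) :
    ∫⁻ ω in U ⁻¹' (Ici t), ENNReal.ofReal (hh g (U ω)) ∂P = ENNReal.ofReal ((1 - t) * g t) := by
  obtain ⟨m, M, hm, hmM⟩ := hh_bounds hg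
  have e1 : ∫⁻ ω in U ⁻¹' (Ici t), ENNReal.ofReal (hh g (U ω)) ∂P =
      ∫⁻ u in Ici t, ENNReal.ofReal (hh g u) ∂(P.map U) := by
    rw [← lintegral_indicator (hU measurableSet_Ici), ← lintegral_indicator measurableSet_Ici,
      lintegral_map' _ hU.aemeasurable]
    · rfl
    · rw [hUd]
      exact ((hh_aemeas hg).ennreal_ofReal).indicator measurableSet_Ici
  have hset : (Ici t ∩ Ioo (0:ℝ) 1 : Set ℝ) =ᵐ[volume] Ioo t 1 := by
    have : ∀ᵐ r : ℝ, r ≠ t := by simp [ae_iff]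
    filter_upwards [this] with r hr
    apply propext
    constructor
    · rintro ⟨a, b, c⟩; exact ⟨lt_of_le_of_ne a (Ne.symm hr), c⟩
    · rintro ⟨a, b⟩; exact ⟨a.le, ht.1.trans_lt a, b⟩
  rw [e1, hUd, Measure.restrict_restrict measurableSet_Ici, Measure.restrict_congr_set hset,
    ← hh_ftc hg ht, ofReal_integral_eq_lintegral_ofReal]
  · exact (hh_intble hg).mono_set (Ioo_subset_Ioo_left ht.1)
  · filter_upwards [ae_restrict_mem measurableSet_Ioo] with u hu
    exact hm.le.trans (hmM u ⟨ht.1.trans_lt hu.1, hu.2⟩).1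

/-- `E_Q[h(U)] = ∫ g dμ` together with integrability and positivity. -/
theorem E_hh (P : Measure Ω) [IsProbabilityMeasure P]
    (D : Ω → ℝ) (hDpos : 0 ≤ D)
    (hDint : Integrable D P) (hD1 : ∫ ω, D ω ∂P = 1)
    (U : Ω → ℝ) (hUmeas : Measurable U)
    (hUd : P.map U = volume.restrict (Set.Ioo (0:ℝ) 1))
    (φ : Measure ℝ) [SigmaFinite (φ.restrict (Ico (0:ℝ) 1))]
    (hφsupp : φ (Set.Icc (0:ℝ) 1)ᶜ = 0)
    (hD : ∀ᵐ ω ∂P, ENNReal.ofReal (D ω) = (φ.restrict (Ico (0:ℝ) 1)) (Iic (U ω)))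
    {g : ℝ → ℝ} (hg : Admissible g) :
    ∫ ω, hh g (U ω) * D ω ∂P = intMu φ g ∧ 0 < intMu φ g ∧
    ∫⁻ t, ENNReal.ofReal ((1 - t) * g t) ∂(φ.restrict (Ico (0:ℝ) 1)) =
      ENNReal.ofReal (intMu φ g) := by
  obtain ⟨m, M, hm, hmM⟩ := hh_bounds hg
  have hUmem : ∀ᵐ ω ∂P, U ω ∈ Ioo (0:ℝ) 1 := by
    have : ∀ᵐ u ∂(P.map U), u ∈ Ioo (0:ℝ) 1 := by
      rw [hUd]; exact ae_restrict_mem measurableSet_Ioo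
    exact ae_of_ae_map hUmeas.aemeasurable this
  have haem : AEMeasurable (fun ω => hh g (U ω)) P :=
    AEMeasurable.comp_aemeasurable (g := hh g) (f := U) (by rw [hUd]; exact hh_aemeas hg)
      hUmeas.aemeasurable
  have hint : Integrable (fun ω => hh g (U ω) * D ω) P := by
    refine hDint.bdd_mul (c := M) haem.aestronglyMeasurable ?_
    filter_upwards [hUmem] with ω hω
    rw [Real.norm_eq_abs, abs_of_nonneg (hm.le.trans (hmM _ hω).1)]
    exact (hmM _ hω).2
  have hnn : 0 ≤ᵐ[P] fun ω => hh g (U ω) * D ω := by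
    filter_upwards [hUmem] with ω hω
    exact mul_nonneg (hm.le.trans (hmM _ hω).1) (hDpos ω)
  have e1 : ENNReal.ofReal (∫ ω, hh g (U ω) * D ω ∂P) =
      ∫⁻ t, ENNReal.ofReal ((1 - t) * g t) ∂(φ.restrict (Ico (0:ℝ) 1)) := by
    rw [ofReal_integral_eq_lintegral_ofReal hint hnn]
    calc _ = ∫⁻ ω, ENNReal.ofReal (hh g (U ω)) * ENNReal.ofReal (D ω) ∂P := by
          apply lintegral_congr
          intro ω
          rw [mul_comm, ENNReal.ofReal_mul (hDpos ω), mul_comm]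
      _ = _ := fubini_D P D U hUmeas _ hD _ haem.ennreal_ofReal
      _ = _ := by
          apply lintegral_congr_ae
          filter_upwards [ae_restrict_mem measurableSet_Ico] with t ht
          exact tail_hh P hUmeas hUd hg ht
  have e2 : ∫ ω, hh g (U ω) * D ω ∂P = intMu φ g := by
    rw [intMu_eq φ hφsupp hg, ← e1, ENNReal.toReal_ofReal (integral_nonneg_of_ae hnn)]
  refine ⟨e2, ?_, ?_⟩
  · rw [← e2]
    have : ∫ ω, m * D ω ∂P ≤ ∫ ω, hh g (U ω) * D ω ∂P := by
      apply integral_mono_ae (hDint.const_mul m) hint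
      filter_upwards [hUmem] with ω hω
      exact mul_le_mul_of_nonneg_right (hmM _ hω).1 (hDpos ω)
    rw [integral_const_mul, hD1] at this
    linarith
  · rw [← e1, e2]

theorem kG_bdd (P : Measure Ω) [IsProbabilityMeasure P] {L : Ω → ℝ} (hL : Measurable L)
    {C : ℝ} (hC : ∀ᵐ ω ∂P, |L ω| ≤ C) {g : ℝ → ℝ} (hg : Admissible g) :
    BddAbove (range fun p : Icc (0:ℝ) 1 => ES P p.1 (fun ω => -L ω) / g p.1) := by
  have hg0 : 0 < g 0 := hg.2.2.1 0 (by simp)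
  have hC0 : 0 ≤ C := by
    obtain ⟨ω, hω⟩ := hC.exists
    exact (abs_nonneg _).trans hω
  have hC' : ∀ᵐ ω ∂P, |(-L ω)| ≤ C := by simpa using hC
  refine ⟨C / g 0, ?_⟩
  rintro _ ⟨⟨p, hp⟩, rfl⟩
  have hgp : g 0 ≤ g p := hg.1 (by simp) hp hp.1
  have key : ES P p (fun ω => -L ω) ≤ C := by
    unfold ES
    split_ifs with hp1
    · have hpa : (0:ℝ) < 1 - p := by linarith
      have hsub : Ioo (0:ℝ) (1 - p) ⊆ Ioo 0 1 := Ioo_subset_Ioo_right (by linarith [hp.1])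
      have : ∫ r in (0:ℝ)..(1 - p), (-C) ≤ ∫ r in (0:ℝ)..(1 - p), qf P (fun ω => -L ω) r := by
        rw [intervalIntegral.integral_of_le hpa.le, intervalIntegral.integral_of_le hpa.le,
          integral_Ioc_eq_integral_Ioo, integral_Ioc_eq_integral_Ioo]
        refine setIntegral_mono_on (by simp) ((qf_intble P hL.neg hC').mono_set hsub)
          measurableSet_Ioo ?_
        intro r hr
        exact (abs_le.1 (qf_bound P hL.neg hC' (hsub hr))).1
      rw [intervalIntegral.integral_const, smul_eq_mul, sub_zero] at this
      have h2 : C = -(1 / (1 - p)) * ((1 - p) * -C) := by field_simp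
      rw [h2]
      apply mul_le_mul_of_nonpos_left this
      have : 0 < 1 / (1 - p) := by positivity
      linarith
    · unfold rhoW
      apply csInf_le
      · refine ⟨-C, fun y hy => ?_⟩
        have hy' : ∀ᵐ ω ∂P, - -L ω ≤ y := hy
        obtain ⟨ω, w1, w2⟩ := (hy'.and hC).exists
        have := (abs_le.1 w2).1
        linarith
      · change ∀ᵐ ω ∂P, - -L ω ≤ C
        filter_upwards [hC] with ω hω
        rw [neg_neg]
        exact (abs_le.1 hω).2
  exact div_le_div₀ hC0 key hg0 hgp

/-- the lower bound -/
theorem E_le_kG (P : Measure Ω) [IsProbabilityMeasure P]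
    (D : Ω → ℝ) (hDpos : 0 ≤ D)
    (hDint : Integrable D P) (hD1 : ∫ ω, D ω ∂P = 1)
    (U : Ω → ℝ) (hUmeas : Measurable U)
    (hUd : P.map U = volume.restrict (Set.Ioo (0:ℝ) 1))
    (φ : Measure ℝ) [SigmaFinite (φ.restrict (Ico (0:ℝ) 1))]
    (hφsupp : φ (Set.Icc (0:ℝ) 1)ᶜ = 0)
    (hD : ∀ᵐ ω ∂P, ENNReal.ofReal (D ω) = (φ.restrict (Ico (0:ℝ) 1)) (Iic (U ω)))
    {g : ℝ → ℝ} (hg : Admissible g) {L : Ω → ℝ} (hL : MemE P L) :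
    0 ≤ kG P g L ∧ ∫ ω, L ω * D ω ∂P ≤ kG P g L * intMu φ g := by
  obtain ⟨Y, ⟨hYm, C₀, hC₀⟩, hLY⟩ := hL
  set Z : Ω → ℝ := fun ω => Real.exp (Y ω) with hZ
  have hZm : Measurable Z := Real.measurable_exp.comp hYm
  have hZpos : ∀ ω, 0 < Z ω := fun ω => Real.exp_pos _
  have hZb : ∀ᵐ ω ∂P, |Z ω| ≤ Real.exp C₀ := by
    filter_upwards [hC₀] with ω hω
    rw [abs_of_pos (hZpos ω)]
    exact Real.exp_le_exp.2 ((le_abs_self _).trans hω)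
  have hZb' : ∀ᵐ ω ∂P, |(-Z ω)| ≤ Real.exp C₀ := by simpa using hZb
  have hZi : Integrable Z P := by
    refine Integrable.of_bound hZm.aestronglyMeasurable (Real.exp C₀) ?_
    simpa using hZb
  rw [kG_congr P g (show L =ᵐ[P] Z from hLY)]
  have hLD : ∫ ω, L ω * D ω ∂P = ∫ ω, Z ω * D ω ∂P := by
    apply integral_congr_ae
    filter_upwards [hLY] with ω hω
    rw [hω]
  rw [hLD]
  have hbdd := kG_bdd P hZm hZb hg
  have htail : ∀ t ∈ Ico (0:ℝ) 1,
      ∫ ω in U ⁻¹' (Ici t), Z ω ∂P ≤ kG P g Z * ((1 - t) * g t) := by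
    intro t ht
    have htI : t ∈ Icc (0:ℝ) 1 := ⟨ht.1, ht.2.le⟩
    have h1 : ES P t (fun ω => -Z ω) / g t ≤ kG P g Z := le_ciSup hbdd ⟨t, htI⟩
    rw [div_le_iff₀ (hg.2.2.1 t htI)] at h1
    have hPA : P.real (U ⁻¹' (Ici t)) = 1 - t := by
      rw [measureReal_def, ← Measure.map_apply hUmeas measurableSet_Ici, hUd,
        Measure.restrict_apply measurableSet_Ici]
      have hset : (Ici t ∩ Ioo (0:ℝ) 1 : Set ℝ) =ᵐ[volume] Ioo t 1 := by
        have : ∀ᵐ r : ℝ, r ≠ t := by simp [ae_iff]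
        filter_upwards [this] with r hr
        apply propext
        constructor
        · rintro ⟨a, b, c⟩; exact ⟨lt_of_le_of_ne a (Ne.symm hr), c⟩
        · rintro ⟨a, b⟩; exact ⟨a.le, ht.1.trans_lt a, b⟩
      rw [measure_congr hset, Real.volume_Ioo, ENNReal.toReal_ofReal (by linarith [ht.2])]
    have h2 := qf_tail_le P hZm.neg hZb' (hUmeas measurableSet_Ici)
      (a := 1 - t) ⟨by linarith [ht.2], by linarith [ht.1]⟩ hPA
    have h3 : (∫ ω in U ⁻¹' (Ici t), (-Z) ω ∂P) = -∫ ω in U ⁻¹' (Ici t), Z ω ∂P :=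
      integral_neg _
    rw [h3] at h2
    have hpos : 0 < 1 - t := by linarith [ht.2]
    have h4 : ES P t (fun ω => -Z ω) * (1 - t) =
        -∫ r in (0:ℝ)..(1 - t), qf P (-Z) r := by
      unfold ES
      rw [if_pos ht.2]
      have : (fun ω => -Z ω) = -Z := rfl
      rw [this]
      field_simp
    have h5 := mul_le_mul_of_nonneg_right h1 hpos.le
    rw [h4] at h5
    linarith
  have hK : 0 ≤ kG P g Z := by
    have h0 := htail 0 (by simp)
    have hnn : 0 ≤ ∫ ω in U ⁻¹' (Ici 0), Z ω ∂P := integral_nonneg fun ω => (hZpos ω).le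
    have hg0 : 0 < g 0 := hg.2.2.1 0 (by simp)
    by_contra! hneg
    have : kG P g Z * ((1 - 0) * g 0) < 0 := by
      rw [sub_zero, one_mul]; exact mul_neg_of_neg_of_pos hneg hg0
    linarith
  refine ⟨hK, ?_⟩
  obtain ⟨-, hIpos, hI⟩ := E_hh P D hDpos hDint hD1 U hUmeas hUd φ hφsupp hD hg
  have hint : Integrable (fun ω => Z ω * D ω) P :=
    hDint.bdd_mul (c := Real.exp C₀) hZm.aestronglyMeasurable hZb
  have hnn : 0 ≤ᵐ[P] fun ω => Z ω * D ω :=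
    Eventually.of_forall fun ω => mul_nonneg (hZpos ω).le (hDpos ω)
  rw [← ENNReal.ofReal_le_ofReal_iff (mul_nonneg hK hIpos.le),
    ofReal_integral_eq_lintegral_ofReal hint hnn]
  calc _ = ∫⁻ ω, ENNReal.ofReal (Z ω) * ENNReal.ofReal (D ω) ∂P := by
        apply lintegral_congr
        intro ω
        rw [ENNReal.ofReal_mul (hZpos ω).le]
    _ = _ := fubini_D P D U hUmeas _ hD _ hZm.ennreal_ofReal.aemeasurable
    _ ≤ ∫⁻ t, ENNReal.ofReal (kG P g Z) * ENNReal.ofReal ((1 - t) * g t)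
          ∂(φ.restrict (Ico (0:ℝ) 1)) := by
        apply lintegral_mono_ae
        filter_upwards [ae_restrict_mem measurableSet_Ico] with t ht
        rw [← ENNReal.ofReal_mul hK, ← ofReal_integral_eq_lintegral_ofReal hZi.integrableOn
          (Eventually.of_forall fun ω => (hZpos ω).le)]
        exact ENNReal.ofReal_le_ofReal (htail t ht)
    _ = _ := by
        rw [lintegral_const_mul' _ _ ENNReal.ofReal_ne_top, hI, ENNReal.ofReal_mul hK]

theorem memE_hh (P : Measure Ω) [IsProbabilityMeasure P] {U : Ω → ℝ} (hU : Measurable U)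
    (hUd : P.map U = volume.restrict (Ioo (0:ℝ) 1)) {g : ℝ → ℝ} (hg : Admissible g)
    {c : ℝ} (hc : 0 < c) : MemE P (fun ω => c * hh g (U ω)) := by
  obtain ⟨m, M, hm, hmM⟩ := hh_bounds hg
  have hUmem : ∀ᵐ ω ∂P, U ω ∈ Ioo (0:ℝ) 1 := by
    have : ∀ᵐ u ∂(P.map U), u ∈ Ioo (0:ℝ) 1 := by
      rw [hUd]; exact ae_restrict_mem measurableSet_Ioo
    exact ae_of_ae_map hU.aemeasurable this
  have haem : AEMeasurable (fun ω => c * hh g (U ω)) P :=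
    (AEMeasurable.comp_aemeasurable (g := hh g) (f := U) (by rw [hUd]; exact hh_aemeas hg)
      hU.aemeasurable).const_mul c
  refine ⟨fun ω => Real.log (haem.mk _ ω), ⟨Real.measurable_log.comp haem.measurable_mk,
    max |Real.log (c * m)| |Real.log (c * M)|, ?_⟩, ?_⟩
  · filter_upwards [haem.ae_eq_mk, hUmem] with ω w1 w2
    rw [← w1]
    have b := hmM _ w2
    apply abs_le_max_abs_abs
    · exact Real.log_le_log (by positivity) (mul_le_mul_of_nonneg_left b.1 hc.le)
    · exact Real.log_le_log (mul_pos hc (hm.trans_le b.1)) (mul_le_mul_of_nonneg_left b.2 hc.le)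
  · filter_upwards [haem.ae_eq_mk, hUmem] with ω w1 w2
    have b := hmM _ w2
    rw [← w1, Real.exp_log (mul_pos hc (hm.trans_le b.1))]

/-- Theorem on risk minimisation, general family `𝒢`. With
`κ(L) = inf_{g ∈ 𝒢} κ_g(L)` and `κ* = x₀ / sup_{g ∈ 𝒢} ∫₀¹ g dμ`:
(a) the optimal value of minimising `κ(L)` over `L ∈ 𝓔` subject to
`E_Q[L] ≥ x₀` is `κ*`; (b) if some `g* ∈ 𝒢` attains `sup_{g ∈ 𝒢} ∫₀¹ g dμ`,
then `L* = -κ* (ĝ*)′₋(U)` is a solution; (c) if a solution exists and the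
infimum defining `κ` is attained on `𝓔`, then such a `g*` exists. -/
theorem statement18 (P : Measure Ω) [IsProbabilityMeasure P] (hP : Atomless P)
    (D : Ω → ℝ) (hDmeas : Measurable D) (hDpos : 0 ≤ D)
    (hDint : Integrable D P) (hD1 : ∫ ω, D ω ∂P = 1)
    (U : Ω → ℝ) (hUmeas : Measurable U)
    (hUdist : P.map U = volume.restrict (Set.Ioo (0:ℝ) 1))
    (hDU : ∀ᵐ ω ∂P, D ω = qf P D (U ω))
    (𝒢 : Set (ℝ → ℝ)) (h𝒢ne : 𝒢.Nonempty) (h𝒢 : ∀ g ∈ 𝒢, Admissible g)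
    (φ : Measure ℝ) (hφfin : ∀ t : ℝ, t < 1 → φ (Set.Icc 0 t) ≠ ⊤)
    (hφsupp : φ (Set.Icc (0:ℝ) 1)ᶜ = 0)
    (hφ : ∀ t ∈ Set.Ico (0:ℝ) 1,
      (φ (Set.Icc 0 t)).toReal = Function.rightLim (qf P D) t)
    (x₀ : ℝ) (hx₀ : 0 < x₀) :
    -- (a) the optimal value is `κ*`
    (sInf {y : ℝ | ∃ L : Ω → ℝ, MemE P L ∧ x₀ ≤ ∫ ω, L ω * D ω ∂P ∧
        y = ⨅ g : 𝒢, kG P (g : ℝ → ℝ) L} =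
      x₀ / ⨆ g : 𝒢, intMu φ (g : ℝ → ℝ)) ∧
    -- (b) if the supremum is attained at `g* ∈ 𝒢`, `L*` is a solution
    (∀ gs : ℝ → ℝ, gs ∈ 𝒢 →
      (∀ g ∈ 𝒢, intMu φ g ≤ intMu φ gs) →
      (MemE P (fun ω => -(x₀ / ⨆ g : 𝒢, intMu φ (g : ℝ → ℝ)) *
          lderiv (fun q => (1 - q) * gs q) (U ω)) ∧
        x₀ ≤ ∫ ω, (-(x₀ / ⨆ g : 𝒢, intMu φ (g : ℝ → ℝ)) *
          lderiv (fun q => (1 - q) * gs q) (U ω)) * D ω ∂P ∧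
        (∀ L : Ω → ℝ, MemE P L → x₀ ≤ ∫ ω, L ω * D ω ∂P →
          (⨅ g : 𝒢, kG P (g : ℝ → ℝ)
              (fun ω => -(x₀ / ⨆ g' : 𝒢, intMu φ (g' : ℝ → ℝ)) *
                lderiv (fun q => (1 - q) * gs q) (U ω))) ≤
            ⨅ g : 𝒢, kG P (g : ℝ → ℝ) L))) ∧
    -- (c) existence of a solution plus attainment of the infimum defining `κ`
    -- forces the supremum to be attained
    ((∃ L : Ω → ℝ, MemE P L ∧ x₀ ≤ ∫ ω, L ω * D ω ∂P ∧
        ∀ L' : Ω → ℝ, MemE P L' → x₀ ≤ ∫ ω, L' ω * D ω ∂P →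
          (⨅ g : 𝒢, kG P (g : ℝ → ℝ) L) ≤ ⨅ g : 𝒢, kG P (g : ℝ → ℝ) L') →
      (∀ L : Ω → ℝ, MemE P L →
        ∃ g ∈ 𝒢, (⨅ g' : 𝒢, kG P (g' : ℝ → ℝ) L) = kG P g L) →
      ∃ gs ∈ 𝒢, ∀ g ∈ 𝒢, intMu φ g ≤ intMu φ gs) := by
  have : SigmaFinite (φ.restrict (Ico (0:ℝ) 1)) := psi_sigmaFinite φ hφfin
  have hD := D_eq_psi P D hDmeas U hUmeas hUdist hDU φ hφfin hφ
  have hE := fun g (hg : g ∈ 𝒢) =>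
    E_hh P D hDpos hDint hD1 U hUmeas hUdist φ hφsupp hD (h𝒢 g hg)
  have hlow := fun g (hg : g ∈ 𝒢) (L : Ω → ℝ) (hL : MemE P L) =>
    E_le_kG P D hDpos hDint hD1 U hUmeas hUdist φ hφsupp hD (h𝒢 g hg) hL
  have hne : Nonempty 𝒢 := h𝒢ne.to_subtype
  have hbdd : ∀ L : Ω → ℝ, MemE P L → BddBelow (range fun g : 𝒢 => kG P (g : ℝ → ℝ) L) := by
    intro L hL
    refine ⟨0, ?_⟩
    rintro _ ⟨g, rfl⟩
    exact (hlow g g.2 L hL).1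
  -- the candidate for a single `g`
  have hcand : ∀ g ∈ 𝒢, MemE P (fun ω => (x₀ / intMu φ g) * hh g (U ω)) ∧
      x₀ ≤ ∫ ω, ((x₀ / intMu φ g) * hh g (U ω)) * D ω ∂P ∧
      (⨅ g' : 𝒢, kG P (g' : ℝ → ℝ) (fun ω => (x₀ / intMu φ g) * hh g (U ω))) ≤
        x₀ / intMu φ g := by
    intro g hg
    obtain ⟨e1, e2, -⟩ := hE g hg
    have hc : 0 < x₀ / intMu φ g := div_pos hx₀ e2
    have hm := memE_hh P hUmeas hUdist (h𝒢 g hg) hc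
    refine ⟨hm, ?_, ?_⟩
    · simp only [mul_assoc]
      rw [integral_const_mul, e1, div_mul_cancel₀ _ e2.ne']
    · exact (ciInf_le (hbdd _ hm) ⟨g, hg⟩).trans (kG_hh_le P hUmeas hUdist (h𝒢 g hg) hc.le)
  have hlow2 : ∀ g ∈ 𝒢, ∀ L : Ω → ℝ, MemE P L → x₀ ≤ ∫ ω, L ω * D ω ∂P →
      x₀ / intMu φ g ≤ kG P g L := by
    intro g hg L hL hx
    rw [div_le_iff₀ (hE g hg).2.1]
    exact hx.trans (hlow g hg L hL).2
  refine ⟨?_, ?_, ?_⟩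
  · set S := {y : ℝ | ∃ L : Ω → ℝ, MemE P L ∧ x₀ ≤ ∫ ω, L ω * D ω ∂P ∧
        y = ⨅ g : 𝒢, kG P (g : ℝ → ℝ) L} with hS
    have hS0 : ∀ y ∈ S, 0 ≤ y := by
      rintro y ⟨L, hL, -, rfl⟩
      exact le_ciInf fun g => (hlow g g.2 L hL).1
    have hSb : BddBelow S := ⟨0, hS0⟩
    have hSne : S.Nonempty := by
      obtain ⟨g, hg⟩ := h𝒢ne
      exact ⟨_, _, (hcand g hg).1, (hcand g hg).2.1, rfl⟩
    have hSle : ∀ g ∈ 𝒢, sInf S ≤ x₀ / intMu φ g := fun g hg =>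
      (csInf_le hSb ⟨_, (hcand g hg).1, (hcand g hg).2.1, rfl⟩).trans (hcand g hg).2.2
    by_cases hB : BddAbove (range fun g : 𝒢 => intMu φ (g : ℝ → ℝ))
    · have hle : ∀ g : 𝒢, intMu φ (g : ℝ → ℝ) ≤ ⨆ g : 𝒢, intMu φ (g : ℝ → ℝ) :=
        fun g => le_ciSup hB g
      have hMpos : 0 < ⨆ g : 𝒢, intMu φ (g : ℝ → ℝ) :=
        (hE hne.some hne.some.2).2.1.trans_le (hle hne.some)
      have hge : x₀ / (⨆ g : 𝒢, intMu φ (g : ℝ → ℝ)) ≤ sInf S := by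
        apply le_csInf hSne
        rintro y ⟨L, hL, hx, rfl⟩
        apply le_ciInf
        intro g
        exact (div_le_div_of_nonneg_left hx₀.le (hE g g.2).2.1 (hle g)).trans
          (hlow2 g g.2 L hL hx)
      have hpos : 0 < sInf S := (div_pos hx₀ hMpos).trans_le hge
      refine le_antisymm ?_ hge
      rw [le_div_iff₀ hMpos, mul_comm, ← le_div_iff₀ hpos]
      apply ciSup_le
      intro g
      rw [le_div_iff₀ hpos, mul_comm, ← le_div_iff₀ (hE g g.2).2.1]
      exact hSle g g.2
    · rw [Real.iSup_of_not_bddAbove hB, div_zero]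
      refine le_antisymm ?_ (le_csInf hSne hS0)
      by_contra! hpos
      apply hB
      refine ⟨x₀ / sInf S, ?_⟩
      rintro _ ⟨g, rfl⟩
      change intMu φ (g : ℝ → ℝ) ≤ _
      rw [le_div_iff₀ hpos, mul_comm, ← le_div_iff₀ (hE g g.2).2.1]
      exact hSle g g.2
  · intro gs hgs hmax
    have hsup : (⨆ g : 𝒢, intMu φ (g : ℝ → ℝ)) = intMu φ gs := by
      apply le_antisymm
      · exact ciSup_le fun g => hmax g g.2
      · refine le_ciSup (f := fun g : 𝒢 => intMu φ (g : ℝ → ℝ)) ⟨intMu φ gs, ?_⟩ ⟨gs, hgs⟩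
        rintro _ ⟨g, rfl⟩
        exact hmax g g.2
    rw [hsup]
    have hfun : ∀ ω, -(x₀ / intMu φ gs) * lderiv (fun q => (1 - q) * gs q) (U ω) =
        (x₀ / intMu φ gs) * hh gs (U ω) := by
      intro ω; unfold hh; ring
    simp only [hfun]
    obtain ⟨c1, c2, c3⟩ := hcand gs hgs
    refine ⟨c1, c2, fun L hL hx => c3.trans ?_⟩
    apply le_ciInf
    intro g
    exact (div_le_div_of_nonneg_left hx₀.le (hE g g.2).2.1 (hmax g g.2)).trans
      (hlow2 g g.2 L hL hx)
  · rintro ⟨L, hL, hx, hopt⟩ hatt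
    obtain ⟨gs, hgs, he⟩ := hatt L hL
    refine ⟨gs, hgs, fun g hg => ?_⟩
    obtain ⟨c1, c2, c3⟩ := hcand g hg
    have h1 := (hlow2 gs hgs L hL hx).trans (he.symm.le.trans ((hopt _ c1 c2).trans c3))
    exact (div_le_div_iff_of_pos_left hx₀ (hE gs hgs).2.1 (hE g hg).2.1).1 h1

end Paper
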